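/- There is an integer E₃ depending only on n and k (the paper computes E₃ = 6ℓ₂ + 3E₂) such that for every triple of k-cliques t_α, t_β, t_γ ∈ C_k: the weighted RNA folding score WRNA(CG_α(t_α) ∘ CG_β(t_β) ∘ CG_γ(t_γ)) equals E₃ if t_α ∪ t_β ∪ t_γ forms a 3k-clique in G, and is at most E₃ − 1 otherwise. -/

import Mathlib

/-!
Formalization of (weighted) RNA folding from
"If the Current Clique Algorithms are Optimal, so is Valiant's Parser"
(Abboud, Backurs, Vassilevska Williams), Section 3.

Letters come from `Σ ∪ Σ'`, modelled as `σ ⊕ σ`: `Sum.inl a` is the letter `a ∈ Σ` and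
`Sum.inr a` is its matching letter `a' ∈ Σ'`.
-/

namespace RNAFolding

/-- Letters `x` and `y` match iff `y = x'` or `x = y'`. -/
def LMatches {σ : Type*} : σ ⊕ σ → σ ⊕ σ → Prop
  | .inl a, .inr b => a = b
  | .inr a, .inl b => a = b
  | _, _ => False

/-- Two pairs of indices `(i₁,j₁)`, `(i₂,j₂)` with `i₁<j₁` and `i₂<j₂` "cross" iff they share an
index, or `i₁<i₂<j₁<j₂`, or `i₂<i₁<j₂<j₁`. -/
def Crosses (p q : ℕ × ℕ) : Prop :=
  p.1 = q.1 ∨ p.1 = q.2 ∨ p.2 = q.1 ∨ p.2 = q.2 ∨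
    (p.1 < q.1 ∧ q.1 < p.2 ∧ p.2 < q.2) ∨ (q.1 < p.1 ∧ p.1 < q.2 ∧ q.2 < p.2)

/-- `A` is a valid folding of `S`: every pair `(i,j) ∈ A` satisfies `i < j < |S|` and the letters
`S[i]`, `S[j]` match, and no two pairs of `A` cross. -/
def IsFolding {σ : Type*} (S : List (σ ⊕ σ)) (A : Finset (ℕ × ℕ)) : Prop :=
  (∀ p ∈ A, p.1 < p.2 ∧ p.2 < S.length ∧ ∃ x ∈ S[p.1]?, ∃ y ∈ S[p.2]?, LMatches x y) ∧
    ∀ p ∈ A, ∀ q ∈ A, p ≠ q → ¬ Crosses p q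

/-- The weighted RNA folding score `WRNA(S)`: the maximum of `∑_{(i,j) ∈ A} w(S[i])` over all
valid foldings `A` of `S` (with the weight function extended to `Σ'` by `w(σ') = w(σ)`). -/
noncomputable def WRNA {σ : Type*} (w : σ → ℕ) (S : List (σ ⊕ σ)) : ℕ :=
  sSup {m | ∃ A : Finset (ℕ × ℕ),
    IsFolding S A ∧ ∑ p ∈ A, (S.map (Sum.elim w w)).getD p.1 0 = m}

/-- The (unweighted) RNA folding score `RNA(S)`: the maximum number of non-crossing matching
pairs, i.e. the weighted score with all weights equal to `1`. -/
noncomputable def RNA {σ : Type*} (S : List (σ ⊕ σ)) : ℕ := WRNA (fun _ => 1) S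

/-! ### The clique-detecting RNA sequence -/

/-- The three pairs of types `αβ`, `αγ`, `βγ`. -/
inductive PT
  | ab | ag | bg
  deriving DecidableEq

/-- The base symbols `0, 1, $, #, g` that get marked with a pair of types. -/
inductive RBase
  | b0 | b1 | dollar | hash | g
  deriving DecidableEq

/-- The 18 plain letters: `Σ = {α, β, γ} ∪ ⋃_{xy ∈ {αβ,αγ,βγ}} {0, 1, $, #, g}_xy`
(together with the matching copies `Σ'` this makes 36 letters). -/
inductive RSig
  | alpha | beta | gamma
  | mk (b : RBase) (p : PT)
  deriving DecidableEq

/-- Letters: a plain (`Sum.inl`) or primed (`Sum.inr`) copy of each symbol of `Σ`. -/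
abbrev RL := RSig ⊕ RSig

/-- A "core" symbol: a base symbol with a primed-ness flag, before marking by a pair of types. -/
abbrev RCore := Bool × RBase

/-- Marking a core symbol with the pair of types `xy`. -/
def mark (p : PT) : RCore → RL
  | (false, b) => .inl (.mk b p)
  | (true, b) => .inr (.mk b p)

/-- `[s]_xy`: marking every letter of a core string with the pair of types `xy`. -/
def markStr (p : PT) (s : List RCore) : List RL := s.map (mark p)

/-- `p(s)`: replacing every letter `σ` by its matching letter `σ'` (and conversely). -/
def primeStr (s : List RCore) : List RCore := s.map (fun x => (!x.1, x.2))

/-- `m`-fold repetition `l^m` of a list. -/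
def rep {α : Type*} (l : List α) (m : ℕ) : List α := (List.replicate m l).flatten

/-- The binary encoding `v̄` of a node `v`, of length exactly `2⌈log n⌉`, as a core string. -/
def bin (n : ℕ) (v : Fin n) : List RCore :=
  (List.range (2 * Nat.clog 2 n)).map
    (fun i => (false, if v.val.testBit i then RBase.b1 else RBase.b0))

/-- The (unprimed) letter `$`. -/
def dol : RCore := (false, .dollar)

/-- The (unprimed) letter `#`. -/
def hsh : RCore := (false, .hash)

open Classical in
/-- The neighbors of `v`, in some fixed order. -/
noncomputable def nbrs (n : ℕ) (G : SimpleGraph (Fin n)) (v : Fin n) : List (Fin n) :=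
  (Finset.univ.filter (fun u => G.Adj v u)).toList

open Classical in
/-- The non-neighbors of `v`, in some fixed order. -/
noncomputable def nonNbrs (n : ℕ) (G : SimpleGraph (Fin n)) (v : Fin n) : List (Fin n) :=
  (Finset.univ.filter (fun u => ¬ G.Adj v u)).toList

/-- The node gadget `NG(v) = $^{2n} v̄ $^{2n}`. -/
def NGr (n : ℕ) (v : Fin n) : List RCore :=
  List.replicate (2 * n) dol ++ bin n v ++ List.replicate (2 * n) dol

/-- The list gadget `LG(v) = (∘_{u ∈ N(v)} ($ ū $)) ∘ (∘_{u ∉ N(v)} ($ $))`. -/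
noncomputable def LGr (n : ℕ) (G : SimpleGraph (Fin n)) (v : Fin n) : List RCore :=
  (nbrs n G v).flatMap (fun u => [dol] ++ bin n u ++ [dol]) ++
    (nonNbrs n G v).flatMap (fun _ => [dol, dol])

/-- The clique node gadget `CNG(t) = ∘_{v ∈ t} (# NG(v) #)^k`. -/
noncomputable def CNGr (n k : ℕ) (t : Finset (Fin n)) : List RCore :=
  t.toList.flatMap (fun v => rep ([hsh] ++ NGr n v ++ [hsh]) k)

/-- The clique list gadget `CLG(t) = (∘_{v ∈ t} (# LG(v) #))^k`. -/
noncomputable def CLGr (n k : ℕ) (G : SimpleGraph (Fin n)) (t : Finset (Fin n)) : List RCore :=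
  rep (t.toList.flatMap (fun v => [hsh] ++ LGr n G v ++ [hsh])) k

/-- `CG_α(t) = [g CNG(t) g]_{αγ} ∘ [g' p(CLG(t))^R g']_{αβ}`. -/
noncomputable def CGa (n k : ℕ) (G : SimpleGraph (Fin n)) (t : Finset (Fin n)) : List RL :=
  markStr .ag ([(false, .g)] ++ CNGr n k t ++ [(false, .g)]) ++
    markStr .ab ([(true, .g)] ++ (primeStr (CLGr n k G t)).reverse ++ [(true, .g)])

/-- `CG_β(t) = [g CNG(t) g]_{αβ} ∘ [g' p(CLG(t))^R g']_{βγ}`. -/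
noncomputable def CGb (n k : ℕ) (G : SimpleGraph (Fin n)) (t : Finset (Fin n)) : List RL :=
  markStr .ab ([(false, .g)] ++ CNGr n k t ++ [(false, .g)]) ++
    markStr .bg ([(true, .g)] ++ (primeStr (CLGr n k G t)).reverse ++ [(true, .g)])

/-- `CG_γ(t) = [g CNG(t) g]_{βγ} ∘ [g' p(CLG(t))^R g']_{αγ}`. -/
noncomputable def CGg (n k : ℕ) (G : SimpleGraph (Fin n)) (t : Finset (Fin n)) : List RL :=
  markStr .bg ([(false, .g)] ++ CNGr n k t ++ [(false, .g)]) ++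
    markStr .ag ([(true, .g)] ++ (primeStr (CLGr n k G t)).reverse ++ [(true, .g)])

/-- `log n` (base 2). -/
def logn (n : ℕ) : ℕ := Nat.log 2 n

/-- `ℓ₁ = 10·k²·n·log n`. -/
def l1 (n k : ℕ) : ℕ := 10 * k ^ 2 * n * logn n

/-- `ℓ₂ = 10·k²·ℓ₁`. -/
def l2 (n k : ℕ) : ℕ := 10 * k ^ 2 * l1 n k

/-- `ℓ₃ = 10·ℓ₂`. -/
def l3 (n k : ℕ) : ℕ := 10 * l2 n k

/-- The weight function: `w(0) = w(1) = 1`, `w($) = 10·log n`, `w(#) = ℓ₁`, `w(g) = ℓ₂`,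
`w(α) = w(β) = w(γ) = ℓ₃`. -/
def wt (n k : ℕ) : RSig → ℕ
  | .alpha => l3 n k
  | .beta => l3 n k
  | .gamma => l3 n k
  | .mk .b0 _ => 1
  | .mk .b1 _ => 1
  | .mk .dollar _ => 10 * logn n
  | .mk .hash _ => l1 n k
  | .mk .g _ => l2 n k

open Classical in
/-- The set `C_k` of `k`-cliques of `G`, in some fixed order. -/
noncomputable def cliqueList (n k : ℕ) (G : SimpleGraph (Fin n)) : List (Finset (Fin n)) :=
  (Finset.univ.filter (fun t => G.IsNClique k t)).toList

/-- The clique-detecting sequence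
`S_G = α^{2n^k} (∘_t α' CG_α(t) α') α^{2n^k} ∘ β^{2n^k} (∘_t β' CG_β(t) β') β^{2n^k} ∘
γ^{2n^k} (∘_t γ' CG_γ(t) γ') γ^{2n^k}`. -/
noncomputable def SG (n k : ℕ) (G : SimpleGraph (Fin n)) : List RL :=
  List.replicate (2 * n ^ k) (.inl .alpha) ++
    (cliqueList n k G).flatMap (fun t => [.inr .alpha] ++ CGa n k G t ++ [.inr .alpha]) ++
    List.replicate (2 * n ^ k) (.inl .alpha) ++
  (List.replicate (2 * n ^ k) (.inl .beta) ++
    (cliqueList n k G).flatMap (fun t => [.inr .beta] ++ CGb n k G t ++ [.inr .beta]) ++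
    List.replicate (2 * n ^ k) (.inl .beta)) ++
  (List.replicate (2 * n ^ k) (.inl .gamma) ++
    (cliqueList n k G).flatMap (fun t => [.inr .gamma] ++ CGg n k G t ++ [.inr .gamma]) ++
    List.replicate (2 * n ^ k) (.inl .gamma))

/-! ### Base-level combinatorics -/

/-- the bit predicate -/
def isBit : RBase → Bool
  | .b0 => true
  | .b1 => true
  | _ => false

def bb (n : ℕ) (v : Fin n) : List RBase := (bin n v).map Prod.snd

def NB (n : ℕ) (v : Fin n) : List RBase :=
  List.replicate (2 * n) .dollar ++ (bb n v ++ List.replicate (2 * n) .dollar)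

noncomputable def LB (n : ℕ) (G : SimpleGraph (Fin n)) (v : Fin n) : List RBase :=
  (nbrs n G v).flatMap (fun u => .dollar :: (bb n u ++ [.dollar])) ++
    (nonNbrs n G v).flatMap (fun _ => [.dollar, .dollar])

theorem bb_length (n : ℕ) (v : Fin n) : (bb n v).length = 2 * Nat.clog 2 n := by
  simp [bb, bin]

theorem bb_isBit (n : ℕ) (v : Fin n) : ∀ x ∈ bb n v, isBit x = true := by
  intro x hx
  simp only [bb, bin, List.map_map, List.mem_map, List.mem_range, Function.comp] at hx
  obtain ⟨i, -, rfl⟩ := hx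
  split <;> rfl

theorem bb_inj (n : ℕ) (u v : Fin n) (h : bb n u = bb n v) : u = v := by
  apply Fin.ext
  apply Nat.eq_of_testBit_eq
  intro i
  by_cases hi : i < 2 * Nat.clog 2 n
  · have := congrArg (fun l => l[i]?) h
    simp only [bb, bin, List.map_map, List.getElem?_map, List.getElem?_range hi,
      Option.map_some, Function.comp, Option.some.injEq] at this
    split at this <;> split at this <;> simp_all
  · have key : ∀ w : Fin n, w.val.testBit i = false := by
      intro w
      apply Nat.testBit_lt_two_pow
      calc w.val < n := w.isLt
        _ ≤ 2 ^ Nat.clog 2 n := Nat.le_pow_clog (by norm_num) n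
        _ ≤ 2 ^ i := Nat.pow_le_pow_right (by norm_num) (by omega)
    rw [key, key]

theorem bb_count (n : ℕ) (v : Fin n) (x : RBase) (hx : isBit x = false) :
    (bb n v).count x = 0 := by
  rw [List.count_eq_zero]
  intro h
  rw [bb_isBit n v x h] at hx
  cases hx

theorem bb_countP (n : ℕ) (v : Fin n) : (bb n v).countP isBit = 2 * Nat.clog 2 n := by
  rw [← bb_length n v, List.countP_eq_length]
  exact bb_isBit n v

theorem sub_block {x : RBase} {B Z : List RBase} (hx : x ∉ B) (h : Z.Sublist (x :: (B ++ [x])))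
    (hc : 2 ≤ Z.count x) : ∃ w, Z = x :: (w ++ [x]) ∧ w.Sublist B := by
  rw [List.sublist_cons_iff] at h
  rcases h with h | ⟨r, rfl, h⟩
  · have := h.count_le x
    simp [List.count_eq_zero.2 hx] at this
    omega
  · rw [List.sublist_append_iff] at h
    obtain ⟨w, s, rfl, hw, hs⟩ := h
    have h1 := hw.count_le x
    rw [List.count_eq_zero.2 hx] at h1
    rw [List.sublist_singleton] at hs
    rcases hs with rfl | rfl
    · rw [List.append_nil, List.count_cons_self] at hc; omega
    · exact ⟨w, rfl, hw⟩

theorem uniq_block {x : RBase} : ∀ {w w' z z' : List RBase}, x ∉ w → x ∉ w' →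
    w ++ x :: z = w' ++ x :: z' → w = w' ∧ z = z'
  | [], [], z, z', _, _, h => by simpa using h
  | [], a :: w', z, z', _, h2, h => by simp at h h2; exact absurd h.1 h2.1
  | a :: w, [], z, z', h1, _, h => by simp at h h1; exact absurd h.1.symm h1.1
  | a :: w, b :: w', z, z', h1, h2, h => by
    simp only [List.cons_append, List.cons.injEq] at h
    have := uniq_block (fun hm => h1 (List.mem_cons_of_mem _ hm))
      (fun hm => h2 (List.mem_cons_of_mem _ hm)) h.2
    exact ⟨by rw [h.1, this.1], this.2⟩

theorem dollar_notin_bb (n : ℕ) (v : Fin n) : RBase.dollar ∉ bb n v :=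
  fun h => by have := bb_isBit n v _ h; cases this

theorem hash_notin_bb (n : ℕ) (v : Fin n) : RBase.hash ∉ bb n v :=
  fun h => by have := bb_isBit n v _ h; cases this

theorem count_dd {α : Type*} (l : List α) :
    (l.flatMap (fun _ => [RBase.dollar, RBase.dollar])).count .dollar = 2 * l.length := by
  induction l with
  | nil => rfl
  | cons a l ih =>
    have : List.count RBase.dollar [RBase.dollar, RBase.dollar] = 2 := by decide
    simp only [List.flatMap_cons, List.count_append, ih, List.length_cons, this]
    omega

theorem count_nb (n : ℕ) (l : List (Fin n)) :
    (l.flatMap (fun u => RBase.dollar :: (bb n u ++ [.dollar]))).count .dollar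
      = 2 * l.length := by
  induction l with
  | nil => rfl
  | cons a l ih =>
    simp only [List.flatMap_cons, List.count_append, ih, List.length_cons, List.count_cons,
      bb_count n a .dollar rfl]
    simp; omega

theorem list_block (n : ℕ) (v : Fin n) (hc : 1 ≤ Nat.clog 2 n) (m : List (Fin n)) :
    ∀ (N : List (Fin n)) (a b : ℕ),
    (List.replicate a RBase.dollar ++ (bb n v ++ List.replicate b RBase.dollar)).Sublist
      (N.flatMap (fun u => RBase.dollar :: (bb n u ++ [RBase.dollar])) ++
        m.flatMap (fun _ => [RBase.dollar, RBase.dollar])) →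
    a + b = 2 * N.length + 2 * m.length → v ∈ N := by
  intro N
  have hpos : 0 < (bb n v).length := by rw [bb_length]; omega
  induction N with
  | nil =>
    intro a b h _
    obtain ⟨x, hx⟩ := List.exists_mem_of_length_pos hpos
    have : x ∈ m.flatMap (fun _ => [RBase.dollar, RBase.dollar]) := by
      have := h.subset (a := x) (by simp [hx])
      simpa using this
    have hd : x = .dollar := by simp at this; exact this.2
    exact absurd (hd ▸ hx) (dollar_notin_bb n v)
  | cons u N ih =>
    intro a b h hab
    rw [List.flatMap_cons, List.append_assoc, List.sublist_append_iff] at h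
    obtain ⟨z1, z2, hz, h1, h2⟩ := h
    have c2 := h2.count_le .dollar
    rw [List.count_append, count_nb, count_dd] at c2
    have ct := congrArg (List.count RBase.dollar) hz
    simp only [List.count_append, bb_count n v .dollar rfl, List.count_replicate_self] at ct
    simp only [List.length_cons] at hab
    obtain ⟨w, rfl, hw⟩ := sub_block (dollar_notin_bb n u) h1 (by omega)
    have hdw : RBase.dollar ∉ w := fun hh => dollar_notin_bb n u (hw.subset hh)
    match a, hab, hz with
    | 0, hab, hz =>
      exfalso
      obtain ⟨x, t, hxt⟩ := List.exists_cons_of_length_pos hpos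
      rw [hxt] at hz
      simp at hz
      exact dollar_notin_bb n v (by rw [hxt, ← hz.1]; simp)
    | 1, hab, hz =>
      obtain ⟨b', rfl⟩ : ∃ b', b = b' + 1 := ⟨b - 1, by omega⟩
      have hz' : bb n v ++ RBase.dollar :: List.replicate b' .dollar = w ++ .dollar :: z2 := by
        simpa [List.replicate_succ] using hz
      obtain ⟨rfl, -⟩ := uniq_block (dollar_notin_bb n v) hdw hz'
      have := bb_inj _ _ _ (hw.eq_of_length (by rw [bb_length, bb_length]))
      simp [this]
    | a + 2, hab, hz =>
      have hz' : [] ++ RBase.dollar :: (List.replicate a .dollar ++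
          (bb n v ++ List.replicate b .dollar)) = w ++ .dollar :: z2 := by
        simpa [List.replicate_succ] using hz
      obtain ⟨rfl, rfl⟩ := uniq_block (by simp) hdw hz'
      exact List.mem_cons_of_mem _ (ih a b h2 (by omega))

theorem nbrs_len (n : ℕ) (G : SimpleGraph (Fin n)) (v : Fin n) :
    (nbrs n G v).length + (nonNbrs n G v).length = n := by
  classical
  simp only [nbrs, nonNbrs, Finset.length_toList]
  have := Finset.card_filter_add_card_filter_not (s := (Finset.univ : Finset (Fin n)))
    (fun u => G.Adj v u)
  simp only [Finset.card_univ, Fintype.card_fin] at this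
  convert this

theorem mem_nbrs (n : ℕ) (G : SimpleGraph (Fin n)) (u v : Fin n) :
    u ∈ nbrs n G v ↔ G.Adj v u := by
  simp [nbrs]

theorem LB_dollar (n : ℕ) (G : SimpleGraph (Fin n)) (v : Fin n) :
    (LB n G v).count .dollar = 2 * n := by
  have := nbrs_len n G v
  rw [LB, List.count_append, count_nb, count_dd]
  omega

theorem LB_hash (n : ℕ) (G : SimpleGraph (Fin n)) (v : Fin n) : RBase.hash ∉ LB n G v := by
  simp [LB, hash_notin_bb]

theorem NB_hash (n : ℕ) (v : Fin n) : RBase.hash ∉ NB n v := by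
  simp [NB, hash_notin_bb]

theorem NB_g (n : ℕ) (v : Fin n) : RBase.g ∉ NB n v := by
  have : RBase.g ∉ bb n v := fun h => by have := bb_isBit n v _ h; cases this
  simp [NB, this]

theorem countP_rep_dollar (m : ℕ) : (List.replicate m RBase.dollar).countP isBit = 0 := by
  simp [isBit]

theorem NB_bits (n : ℕ) (v : Fin n) : (NB n v).countP isBit = 2 * Nat.clog 2 n := by
  simp only [NB, List.countP_append, countP_rep_dollar, bb_countP]; omega

theorem block_adj (n : ℕ) (G : SimpleGraph (Fin n)) (u v : Fin n) (hc : 1 ≤ Nat.clog 2 n)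
    (w : List RBase) (h1 : w.Sublist (NB n u)) (h2 : w.Sublist (LB n G v))
    (hd : w.count .dollar = 2 * n) (hb : w.countP isBit = 2 * Nat.clog 2 n) : G.Adj v u := by
  rw [← mem_nbrs]
  rw [NB, List.sublist_append_iff] at h1
  obtain ⟨a, r, rfl, ha, hr⟩ := h1
  rw [List.sublist_append_iff] at hr
  obtain ⟨m, b, rfl, hm, hb'⟩ := hr
  rw [List.sublist_replicate_iff] at ha hb'
  obtain ⟨i, -, rfl⟩ := ha
  obtain ⟨j, -, rfl⟩ := hb'
  simp only [List.countP_append, countP_rep_dollar] at hb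
  have hl : m.countP isBit ≤ m.length := List.countP_le_length
  have hm' : m = bb n u := hm.eq_of_length_le (by rw [bb_length]; omega)
  subst hm'
  simp only [List.count_append, bb_count n u .dollar rfl, List.count_replicate_self] at hd
  have := nbrs_len n G v
  exact list_block n u hc (nonNbrs n G v) (nbrs n G v) i j h2 (by omega)

theorem block_exists (n : ℕ) (G : SimpleGraph (Fin n)) (u v : Fin n) (h : G.Adj v u) :
    ∃ w : List RBase, w.Sublist (NB n u) ∧ w.Sublist (LB n G v) ∧
    w.count .dollar = 2 * n ∧ w.countP isBit = 2 * Nat.clog 2 n := by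
  rw [← mem_nbrs] at h
  obtain ⟨l1, l2, hl⟩ := List.append_of_mem h
  have hn := nbrs_len n G v
  rw [hl] at hn
  simp only [List.length_append, List.length_cons] at hn
  have hX : ∀ l : List (Fin n), (List.replicate (2 * l.length) RBase.dollar).Sublist
      (l.flatMap (fun u => RBase.dollar :: (bb n u ++ [.dollar]))) := by
    intro l
    rw [List.replicate_sublist_iff, count_nb]
  have hY : (List.replicate (2 * (nonNbrs n G v).length) RBase.dollar).Sublist
      ((nonNbrs n G v).flatMap (fun _ => [RBase.dollar, RBase.dollar])) := by
    rw [List.replicate_sublist_iff, count_dd]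
  refine ⟨List.replicate (2 * l1.length + 1) .dollar ++ (bb n u ++
    List.replicate (1 + 2 * l2.length + 2 * (nonNbrs n G v).length) .dollar), ?_, ?_, ?_, ?_⟩
  · refine List.Sublist.append ?_ (List.Sublist.append (List.Sublist.refl _) ?_)
    · rw [List.replicate_sublist_replicate]; omega
    · rw [List.replicate_sublist_replicate]; omega
  · rw [LB, hl]
    have := ((hX l1).append ((List.Sublist.refl (RBase.dollar :: (bb n u ++ [.dollar]))).append
      ((hX l2).append hY)))
    have e1 : List.replicate (2 * l1.length + 1) RBase.dollar
        = List.replicate (2 * l1.length) .dollar ++ [.dollar] := by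
      rw [List.replicate_add]; rfl
    have e2 : List.replicate (1 + 2 * l2.length + 2 * (nonNbrs n G v).length) RBase.dollar
        = [.dollar] ++ (List.replicate (2 * l2.length) .dollar ++
          List.replicate (2 * (nonNbrs n G v).length) .dollar) := by
      rw [List.replicate_add, List.replicate_add, List.append_assoc]; rfl
    rw [e1, e2]
    simpa only [List.flatMap_append, List.flatMap_cons, List.append_assoc, List.cons_append,
      List.nil_append] using this
  · simp only [List.count_append, bb_count n u .dollar rfl, List.count_replicate_self]
    omega
  · simp only [List.countP_append, countP_rep_dollar, bb_countP]; omega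

def NP (n : ℕ) (Ps : List (Fin n × Fin n)) : List RBase :=
  Ps.flatMap (fun p => .hash :: (NB n p.1 ++ [.hash]))

noncomputable def LP (n : ℕ) (G : SimpleGraph (Fin n)) (Ps : List (Fin n × Fin n)) :
    List RBase :=
  Ps.flatMap (fun p => .hash :: (LB n G p.2 ++ [.hash]))

theorem NP_counts (n : ℕ) (Ps : List (Fin n × Fin n)) :
    (NP n Ps).count .hash = 2 * Ps.length ∧
    (NP n Ps).countP isBit = 2 * Nat.clog 2 n * Ps.length ∧
    (NP n Ps).count .g = 0 := by
  induction Ps with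
  | nil => simp [NP]
  | cons p Ps ih =>
    obtain ⟨h1, h2, h3⟩ := ih
    rw [NP] at h1 h2 h3 ⊢
    rw [List.flatMap_cons]
    simp only [List.count_append, List.countP_append, h1, h2, h3, List.count_cons,
      List.countP_cons, NB_bits, List.count_eq_zero.2 (NB_hash n p.1),
      List.count_eq_zero.2 (NB_g n p.1), List.length_cons, List.count_nil, List.countP_nil,
      mul_add]
    refine ⟨?_, ?_, ?_⟩ <;> simp [isBit] <;> omega

theorem LP_counts (n : ℕ) (G : SimpleGraph (Fin n)) (Ps : List (Fin n × Fin n)) :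
    (LP n G Ps).count .hash = 2 * Ps.length ∧
    (LP n G Ps).count .dollar = 2 * n * Ps.length := by
  induction Ps with
  | nil => simp [LP]
  | cons p Ps ih =>
    obtain ⟨h1, h2⟩ := ih
    rw [LP] at h1 h2 ⊢
    rw [List.flatMap_cons]
    simp only [List.count_append, h1, h2, List.count_cons,
      LB_dollar, List.count_eq_zero.2 (LB_hash n G p.2),
      List.length_cons, List.count_nil, mul_add]
    refine ⟨?_, ?_⟩ <;> simp <;> omega

theorem all_adj (n : ℕ) (G : SimpleGraph (Fin n)) (hc : 1 ≤ Nat.clog 2 n) :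
    ∀ (Ps : List (Fin n × Fin n)) (Z : List RBase), Z.Sublist (NP n Ps) →
    Z.Sublist (LP n G Ps) → Z.count .hash = 2 * Ps.length →
    Z.count .dollar = 2 * n * Ps.length → Z.countP isBit = 2 * Nat.clog 2 n * Ps.length →
    ∀ p ∈ Ps, G.Adj p.2 p.1 := by
  intro Ps
  induction Ps with
  | nil => simp
  | cons p Ps ih =>
    intro Z hN hL ch cd cb
    obtain ⟨nh, nb, -⟩ := NP_counts n Ps
    obtain ⟨lh, ld⟩ := LP_counts n G Ps
    rw [NP, List.flatMap_cons, ← NP, List.sublist_append_iff] at hN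
    rw [LP, List.flatMap_cons, ← LP, List.sublist_append_iff] at hL
    obtain ⟨z1, z2, rfl, h1, h2⟩ := hN
    obtain ⟨y1, y2, hy, g1, g2⟩ := hL
    simp only [List.length_cons, mul_add, List.count_append, List.countP_append] at ch cd cb
    have ch' := ch
    have hyc := congrArg (List.count RBase.hash) hy
    simp only [List.count_append] at hyc
    have e1 := h2.count_le .hash
    have e2 := g2.count_le .hash
    obtain ⟨w, rfl, hw⟩ := sub_block (NB_hash n p.1) h1 (by omega)
    obtain ⟨x, rfl, hx⟩ := sub_block (LB_hash n G p.2) g1 (by omega)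
    have hhw : RBase.hash ∉ w := fun hh => NB_hash n p.1 (hw.subset hh)
    have hhx : RBase.hash ∉ x := fun hh => LB_hash n G p.2 (hx.subset hh)
    have hy' : w ++ .hash :: z2 = x ++ .hash :: y2 := by simpa using hy
    obtain ⟨rfl, rfl⟩ := uniq_block hhw hhx hy'
    have wd := hx.count_le .dollar
    have wb := hw.countP_le (p := isBit)
    rw [LB_dollar] at wd
    rw [NB_bits] at wb
    have zd := g2.count_le .dollar
    have zb := h2.countP_le (p := isBit)
    have k1 : (RBase.hash :: (w ++ [.hash])).count .dollar = w.count .dollar := by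
      simp
    have k2 : (RBase.hash :: (w ++ [.hash])).countP isBit = w.countP isBit := by
      simp [isBit]
    have k3 : (RBase.hash :: (w ++ [.hash])).count .hash = 2 := by
      simp [List.count_eq_zero.2 hhw]
    rw [k1] at cd
    rw [k2] at cb
    rw [k3] at ch
    have := block_adj n G p.1 p.2 hc w hw hx (by omega) (by omega)
    intro q hq
    rcases List.mem_cons.1 hq with rfl | hq
    · exact this
    · exact ih z2 h2 g2 (by omega) (by omega) (by omega) q hq

theorem exists_common (n : ℕ) (G : SimpleGraph (Fin n)) :
    ∀ (Ps : List (Fin n × Fin n)), (∀ p ∈ Ps, G.Adj p.2 p.1) →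
    ∃ Z : List RBase, Z.Sublist (NP n Ps) ∧
    Z.Sublist (LP n G Ps) ∧ Z.count .hash = 2 * Ps.length ∧
    Z.count .dollar = 2 * n * Ps.length ∧ Z.countP isBit = 2 * Nat.clog 2 n * Ps.length := by
  intro Ps
  induction Ps with
  | nil => intro _; exact ⟨[], by simp⟩
  | cons p Ps ih =>
    intro h
    obtain ⟨Z, a, b, c, d, e⟩ := ih (fun q hq => h q (List.mem_cons_of_mem _ hq))
    obtain ⟨w, hw, hx, hd, hb⟩ := block_exists n G p.1 p.2 (h p (by simp))
    have hhw : RBase.hash ∉ w := fun hh => NB_hash n p.1 (hw.subset hh)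
    refine ⟨.hash :: (w ++ [.hash]) ++ Z, ?_, ?_, ?_, ?_, ?_⟩
    · rw [NP, List.flatMap_cons, ← NP]
      exact ((hw.append (List.Sublist.refl _)).cons_cons _).append a
    · rw [LP, List.flatMap_cons, ← LP]
      exact ((hx.append (List.Sublist.refl _)).cons_cons _).append b
    · simp [List.count_eq_zero.2 hhw, c]; omega
    · simp [d, hd, mul_add]; omega
    · simp [e, hb, mul_add, isBit]; omega

/-- weights of base letters -/
def wb (n k : ℕ) (b : RBase) : ℕ := wt n k (.mk b .ab)

theorem wb_sum (n k : ℕ) (Z : List RBase) : (Z.map (wb n k)).sum =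
    l2 n k * Z.count .g + l1 n k * Z.count .hash + 10 * logn n * Z.count .dollar
      + Z.countP isBit := by
  induction Z with
  | nil => simp
  | cons b Z ih =>
    rw [List.map_cons, List.sum_cons, ih]
    cases b <;> simp [wb, wt, isBit, mul_add, List.countP_cons] <;> omega

/-- the threshold for a pair -/
def EE (n k : ℕ) : ℕ :=
  l2 n k * 2 + l1 n k * (2 * (k * k)) + 10 * logn n * (2 * n * (k * k))
    + 2 * Nat.clog 2 n * (k * k)

def gw (s : List RBase) : List RBase := .g :: (s ++ [.g])

theorem pair_le (n k : ℕ) (G : SimpleGraph (Fin n)) (Ps : List (Fin n × Fin n))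
    (hPs : Ps.length = k * k) (Z : List RBase) (h1 : Z.Sublist (gw (NP n Ps)))
    (h2 : Z.Sublist (gw (LP n G Ps))) : (Z.map (wb n k)).sum ≤ EE n k := by
  obtain ⟨nh, nb, ng⟩ := NP_counts n Ps
  obtain ⟨lh, ld⟩ := LP_counts n G Ps
  have c1 := h1.count_le .g
  have c2 := h1.count_le .hash
  have c3 := h2.count_le .dollar
  have c4 := h1.countP_le (p := isBit)
  rw [hPs] at nh nb ld
  simp [gw, ng, nh, nb, ld, isBit] at c1 c2 c3 c4
  rw [wb_sum, EE]
  gcongr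

theorem pair_eq (n k : ℕ) (hn : 2 ≤ n) (hk : 1 ≤ k) (G : SimpleGraph (Fin n))
    (Ps : List (Fin n × Fin n))
    (hPs : Ps.length = k * k) (Z : List RBase) (h1 : Z.Sublist (gw (NP n Ps)))
    (h2 : Z.Sublist (gw (LP n G Ps))) (hE : (Z.map (wb n k)).sum = EE n k) :
    ∀ p ∈ Ps, G.Adj p.2 p.1 := by
  obtain ⟨nh, nb, ng⟩ := NP_counts n Ps
  obtain ⟨lh, ld⟩ := LP_counts n G Ps
  have c1 := h1.count_le .g
  have c2 := h1.count_le .hash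
  have c3 := h2.count_le .dollar
  have c4 := h1.countP_le (p := isBit)
  rw [hPs] at nh nb ld
  simp [gw, ng, nh, nb, ld, isBit] at c1 c2 c3 c4
  rw [wb_sum, EE] at hE
  have hL : 0 < logn n := Nat.log_pos (by norm_num) hn
  have hl1 : 0 < l1 n k := by unfold l1; positivity
  have hC : 1 ≤ Nat.clog 2 n := Nat.clog_pos (by norm_num) hn
  have m1 := Nat.mul_le_mul_left (l2 n k) c1
  have m2 := Nat.mul_le_mul_left (l1 n k) c2
  have m3 := Nat.mul_le_mul_left (10 * logn n) c3
  have e2 : Z.count .hash = 2 * (k * k) := Nat.eq_of_mul_eq_mul_left hl1 (by omega)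
  have e3 : Z.count .dollar = 2 * n * (k * k) :=
    Nat.eq_of_mul_eq_mul_left (show 0 < 10 * logn n by omega) (by omega)
  have e4 : Z.countP isBit = 2 * Nat.clog 2 n * (k * k) := by omega
  let f : RBase → Bool := fun b => b != .g
  have hNg : (gw (NP n Ps)).filter f = (NP n Ps).filter f := by simp [gw, f]
  have hLg : (gw (LP n G Ps)).filter f = (LP n G Ps).filter f := by simp [gw, f]
  refine all_adj n G hC Ps (Z.filter f) ?_ ?_ ?_ ?_ ?_
  · exact (h1.filter f).trans (by rw [hNg]; exact List.filter_sublist)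
  · exact (h2.filter f).trans (by rw [hLg]; exact List.filter_sublist)
  · rw [List.count_filter (by rfl), e2, hPs]
  · rw [List.count_filter (by rfl), e3, hPs]
  · rw [List.countP_filter, hPs, ← e4]
    congr 1
    funext b
    cases b <;> rfl

theorem pair_exists (n k : ℕ) (G : SimpleGraph (Fin n)) (Ps : List (Fin n × Fin n))
    (hPs : Ps.length = k * k) (h : ∀ p ∈ Ps, G.Adj p.2 p.1) :
    ∃ Z : List RBase, Z.Sublist (gw (NP n Ps)) ∧ Z.Sublist (gw (LP n G Ps)) ∧
      (Z.map (wb n k)).sum = EE n k := by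
  obtain ⟨Z, a, b, c, d, e⟩ := exists_common n G Ps h
  have hg : Z.count .g = 0 := by
    have := a.count_le .g
    rw [(NP_counts n Ps).2.2] at this
    omega
  refine ⟨gw Z, ?_, ?_, ?_⟩
  · exact (a.append (List.Sublist.refl _)).cons_cons _
  · exact (b.append (List.Sublist.refl _)).cons_cons _
  · rw [wb_sum, EE]
    simp [gw, hg, c, d, e, hPs, isBit]

/-! ### Strings as flatMaps over pairs -/

theorem rep_eq {α β : Type*} (l : List α) (t : List β) :
    rep l t.length = t.flatMap (fun _ => l) := by
  rw [rep, List.flatMap_def, List.map_const']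

theorem NGr_snd (n : ℕ) (v : Fin n) : (NGr n v).map Prod.snd = NB n v := by
  simp [NGr, NB, bb, dol]

theorem LGr_snd (n : ℕ) (G : SimpleGraph (Fin n)) (v : Fin n) :
    (LGr n G v).map Prod.snd = LB n G v := by
  simp [LGr, LB, bb, dol, List.map_flatMap]

theorem CNGr_snd (n k : ℕ) (t s : Finset (Fin n)) (hs : s.card = k) :
    (CNGr n k t).map Prod.snd = NP n (t.toList.product s.toList) := by
  have hl : s.toList.length = k := by simp [hs]
  subst hl
  simp only [CNGr, NP, rep_eq, List.product, List.map_flatMap, List.flatMap_assoc,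
    List.flatMap_map]
  simp [NGr_snd, hsh]

theorem CLGr_snd (n k : ℕ) (G : SimpleGraph (Fin n)) (t s : Finset (Fin n)) (ht : t.card = k) :
    (CLGr n k G s).map Prod.snd = LP n G (t.toList.product s.toList) := by
  have hl : t.toList.length = k := by simp [ht]
  subst hl
  simp only [CLGr, LP, rep_eq, List.product, List.map_flatMap, List.flatMap_assoc,
    List.flatMap_map]
  simp [LGr_snd, hsh]

/-! ### Extracting a common sublist from a folding -/

/-- the underlying symbol -/
def sig : RL → RSig := Sum.elim id id

theorem sublist_getD {α : Type*} (X : List α) (d : α) (l : List ℕ) (hl : l.Pairwise (· < ·))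
    (hb : ∀ i ∈ l, i < X.length) : (l.map (fun i => X.getD i d)).Sublist X := by
  have h1 : l.Sublist (List.range X.length) := by
    apply List.sublist_of_subperm_of_pairwise (r := (· < ·)) _ hl List.pairwise_lt_range
    apply List.subperm_of_subset
    · exact hl.imp (fun h => ne_of_lt h)
    · intro i hi
      exact List.mem_range.2 (hb i hi)
  have h2 := h1.map (fun i => X.getD i d)
  have h3 : (List.range X.length).map (fun i => X.getD i d) = X := by
    apply List.ext_getElem
    · simp
    · intro i h1 h2
      simp [h2]
  rwa [h3] at h2

theorem matches_sig {x y : RL} (h : LMatches x y) : sig x = sig y ∧ x.isLeft = !y.isLeft := by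
  cases x <;> cases y <;> simp_all [LMatches, sig]

open Classical in
theorem extract (w : RSig → ℕ) (T : RSig → Bool) (P R : List RL) (b : Bool)
    (hP : ∀ x ∈ P, T (sig x) = true → x.isLeft = b)
    (hR : ∀ x ∈ R, T (sig x) = true → x.isLeft = !b)
    (A : Finset (ℕ × ℕ)) (hA : IsFolding (P ++ R) A) :
    ∃ Z : List RSig, Z.Sublist ((P.map sig).filter T) ∧
      Z.reverse.Sublist ((R.map sig).filter T) ∧
      ∑ p ∈ A.filter (fun p => ∃ x ∈ (P ++ R)[p.1]?, T (sig x) = true),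
        ((P ++ R).map (Sum.elim w w)).getD p.1 0 = (Z.map w).sum := by
  set B := A.filter (fun p => ∃ x ∈ (P ++ R)[p.1]?, T (sig x) = true) with hB
  have key : ∀ p ∈ B, p.1 < P.length ∧ P.length ≤ p.2 ∧ p.2 - P.length < R.length ∧
      T ((P.map sig).getD p.1 .alpha) = true ∧
      (P.map sig).getD p.1 .alpha = (R.map sig).getD (p.2 - P.length) .alpha ∧
      ((P ++ R).map (Sum.elim w w)).getD p.1 0 = w ((P.map sig).getD p.1 .alpha) := by
    intro p hp
    rw [hB, Finset.mem_filter] at hp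
    obtain ⟨hpA, x, hx, hT⟩ := hp
    obtain ⟨h1, h2, x', hx', y, hy, hm⟩ := hA.1 p hpA
    have hxx : x' = x := by
      rw [Option.mem_def] at hx hx'
      rw [hx] at hx'
      exact (Option.some.inj hx').symm
    subst hxx
    obtain ⟨hs, hf⟩ := matches_sig hm
    rw [Option.mem_def] at hx hy
    rw [List.length_append] at h2
    have c1 : p.1 < P.length := by
      by_contra hcon
      have hx1 : x' ∈ R := by
        rw [List.getElem?_append_right (by omega)] at hx
        exact List.mem_of_getElem? hx
      have hy1 : y ∈ R := by
        rw [List.getElem?_append_right (by omega)] at hy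
        exact List.mem_of_getElem? hy
      have a1 := hR _ hx1 hT
      have a2 := hR _ hy1 (hs ▸ hT)
      rw [a1, a2] at hf
      cases b <;> cases hf
    have hx2 : P[p.1]? = some x' := by rwa [List.getElem?_append_left c1] at hx
    have hx1 : x' ∈ P := List.mem_of_getElem? hx2
    have c2 : P.length ≤ p.2 := by
      by_contra hcon
      have hy1 : y ∈ P := by
        rw [List.getElem?_append_left (by omega)] at hy
        exact List.mem_of_getElem? hy
      have a1 := hP _ hx1 hT
      have a2 := hP _ hy1 (hs ▸ hT)
      rw [a1, a2] at hf
      cases b <;> cases hf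
    have hy2 : R[p.2 - P.length]? = some y := by rwa [List.getElem?_append_right c2] at hy
    have e1 : (P.map sig).getD p.1 .alpha = sig x' := by
      rw [List.getD_eq_getElem?_getD, List.getElem?_map, hx2]; rfl
    have e2 : (R.map sig).getD (p.2 - P.length) .alpha = sig y := by
      rw [List.getD_eq_getElem?_getD, List.getElem?_map, hy2]; rfl
    refine ⟨c1, c2, by omega, by rw [e1, hT], by rw [e1, e2, hs], ?_⟩
    rw [e1, List.getD_eq_getElem?_getD, List.getElem?_map, hx]
    cases x' <;> rfl
  let r : ℕ × ℕ → ℕ × ℕ → Prop := fun p q => p.1 ≤ q.1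
  have : Std.Total r := ⟨fun p q => le_total p.1 q.1⟩
  have : IsTrans (ℕ × ℕ) r := ⟨fun p q s h1 h2 => le_trans (b := q.1) h1 h2⟩
  let l := B.toList.insertionSort r
  have hperm : l.Perm B.toList := List.perm_insertionSort r _
  have hmem : ∀ p, p ∈ l ↔ p ∈ B := fun p => by rw [hperm.mem_iff, Finset.mem_toList]
  have hnd : l.Nodup := hperm.nodup_iff.2 B.nodup_toList
  have hsort : l.Pairwise r := List.pairwise_insertionSort r _
  have hpair : l.Pairwise (fun p q => p.1 < q.1 ∧ q.2 < p.2) := by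
    have h := hsort.and hnd
    refine List.Pairwise.imp_of_mem ?_ h
    intro p q hp hq ⟨h1, h2⟩
    rw [hmem] at hp hq
    have kp := key p hp
    have kq := key q hq
    have hc := hA.2 p (Finset.mem_filter.1 hp).1 q (Finset.mem_filter.1 hq).1 h2
    simp only [Crosses, not_or] at hc
    have h1' : p.1 ≤ q.1 := h1
    omega
  refine ⟨l.map (fun p => (P.map sig).getD p.1 .alpha), ?_, ?_, ?_⟩
  · have h1 := sublist_getD (P.map sig) .alpha (l.map Prod.fst)
      (by rw [List.pairwise_map]; exact hpair.imp (fun h => h.1))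
      (by
        intro i hi
        obtain ⟨p, hp, rfl⟩ := List.mem_map.1 hi
        simpa using (key p ((hmem p).1 hp)).1)
    rw [List.map_map] at h1
    have h2 := h1.filter T
    rw [List.filter_eq_self.2] at h2
    · exact h2
    · intro a ha
      obtain ⟨p, hp, rfl⟩ := List.mem_map.1 ha
      exact (key p ((hmem p).1 hp)).2.2.2.1
  · have h1 := sublist_getD (R.map sig) .alpha (l.reverse.map (fun p => p.2 - P.length))
      (by
        rw [List.pairwise_map, List.pairwise_reverse]
        refine List.Pairwise.imp_of_mem ?_ hpair
        intro p q hp hq h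
        have kp := key p ((hmem p).1 hp)
        have kq := key q ((hmem q).1 hq)
        omega)
      (by
        intro i hi
        obtain ⟨p, hp, rfl⟩ := List.mem_map.1 hi
        rw [List.mem_reverse] at hp
        simpa using (key p ((hmem p).1 hp)).2.2.1)
    rw [List.map_map] at h1
    have h2 := h1.filter T
    have h3 : l.reverse.map ((fun i => (R.map sig).getD i .alpha) ∘ fun p => p.2 - P.length)
        = (l.map (fun p => (P.map sig).getD p.1 .alpha)).reverse := by
      rw [← List.map_reverse]
      apply List.map_congr_left
      intro p hp
      rw [List.mem_reverse] at hp
      exact (key p ((hmem p).1 hp)).2.2.2.2.1.symm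
    rw [h3] at h2
    rw [List.filter_eq_self.2] at h2
    · exact h2
    · intro a ha
      rw [List.mem_reverse] at ha
      obtain ⟨p, hp, rfl⟩ := List.mem_map.1 ha
      exact (key p ((hmem p).1 hp)).2.2.2.1
  · rw [← Finset.sum_map_toList, ← (hperm.map _).sum_eq, List.map_map]
    congr 1
    apply List.map_congr_left
    intro p hp
    exact (key p ((hmem p).1 hp)).2.2.2.2.2

/-! ### Building foldings -/

/-- `m` is the weight of some folding of `S`. -/
def Ach (w : RSig → ℕ) (S : List RL) (m : ℕ) : Prop :=
  ∃ A : Finset (ℕ × ℕ), IsFolding S A ∧ ∑ p ∈ A, (S.map (Sum.elim w w)).getD p.1 0 = m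

theorem Ach.zero (w : RSig → ℕ) (S : List RL) : Ach w S 0 :=
  ⟨∅, ⟨by simp, by simp⟩, by simp⟩

/-- shift of a pair -/
def shp (d : ℕ) : ℕ × ℕ ↪ ℕ × ℕ :=
  ⟨fun p => (p.1 + d, p.2 + d), fun p q h => by
    simp only [Prod.mk.injEq, Nat.add_right_cancel_iff] at h
    exact Prod.ext h.1 h.2⟩

theorem shp_apply (d : ℕ) (p : ℕ × ℕ) : shp d p = (p.1 + d, p.2 + d) := rfl

theorem IsFolding.pad {X S Y : List RL} {A : Finset (ℕ × ℕ)} (h : IsFolding S A) :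
    IsFolding (X ++ (S ++ Y)) (A.map (shp X.length)) := by
  have hs : ∀ i, i < S.length → (X ++ (S ++ Y))[i + X.length]? = S[i]? := by
    intro i hi
    rw [List.getElem?_append_right (by omega), List.getElem?_append_left (by omega)]
    congr 1; omega
  constructor
  · intro p hp
    obtain ⟨q, hq, rfl⟩ := Finset.mem_map.1 hp
    obtain ⟨h1, h2, h3⟩ := h.1 q hq
    simp only [shp_apply, List.length_append]
    refine ⟨by omega, by omega, ?_⟩
    rw [hs _ (by omega), hs _ h2]
    exact h3
  · intro p hp q hq hpq hc
    obtain ⟨p, hp', rfl⟩ := Finset.mem_map.1 hp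
    obtain ⟨q, hq', rfl⟩ := Finset.mem_map.1 hq
    apply h.2 p hp' q hq' (fun h => hpq (by rw [h]))
    simp only [shp_apply, Crosses] at hc ⊢
    omega

theorem pad_sum (w : RSig → ℕ) {X S Y : List RL} {A : Finset (ℕ × ℕ)} (h : IsFolding S A) :
    ∑ p ∈ A.map (shp X.length), ((X ++ (S ++ Y)).map (Sum.elim w w)).getD p.1 0
      = ∑ p ∈ A, (S.map (Sum.elim w w)).getD p.1 0 := by
  rw [Finset.sum_map]
  apply Finset.sum_congr rfl
  intro p hp
  obtain ⟨h1, h2, -⟩ := h.1 p hp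
  simp only [shp_apply, List.getD_eq_getElem?_getD, List.getElem?_map]
  rw [List.getElem?_append_right (by omega), List.getElem?_append_left (by omega),
    Nat.add_sub_cancel]

theorem Ach.append {w : RSig → ℕ} {S T : List RL} {a b : ℕ} (h1 : Ach w S a) (h2 : Ach w T b) :
    Ach w (S ++ T) (a + b) := by
  obtain ⟨A, hA, rfl⟩ := h1
  obtain ⟨B, hB, rfl⟩ := h2
  have fA := hA.pad (X := []) (Y := T)
  have fB := hB.pad (X := S) (Y := [])
  have sA := pad_sum w hA (X := []) (Y := T)
  have sB := pad_sum w hB (X := S) (Y := [])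
  simp only [List.nil_append, List.append_nil] at fA fB sA sB
  have hlA : ∀ p ∈ A.map (shp ([] : List RL).length), p.1 < p.2 ∧ p.2 < S.length := by
    intro p hp
    obtain ⟨q, hq, rfl⟩ := Finset.mem_map.1 hp
    have := hA.1 q hq
    exact ⟨by simpa [shp_apply] using this.1, by simpa [shp_apply] using this.2.1⟩
  have hlB : ∀ p ∈ B.map (shp S.length), S.length ≤ p.1 ∧ p.1 < p.2 := by
    intro p hp
    have := fB.1 p hp
    obtain ⟨q, hq, rfl⟩ := Finset.mem_map.1 hp
    exact ⟨by simp [shp_apply], this.1⟩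
  refine ⟨A.map (shp ([] : List RL).length) ∪ B.map (shp S.length), ⟨?_, ?_⟩, ?_⟩
  · intro p hp
    rcases Finset.mem_union.1 hp with hp | hp
    · exact fA.1 p hp
    · exact fB.1 p hp
  · intro p hp q hq hpq
    rcases Finset.mem_union.1 hp with hp | hp <;> rcases Finset.mem_union.1 hq with hq | hq
    · exact fA.2 p hp q hq hpq
    · have := hlA p hp
      have := hlB q hq
      simp only [Crosses]; omega
    · have := hlB p hp
      have := hlA q hq
      simp only [Crosses]; omega
    · exact fB.2 p hp q hq hpq
  · rw [Finset.sum_union, sA, sB]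
    rw [Finset.disjoint_left]
    intro p hp hq
    have := hlA p hp
    have := hlB p hq
    omega

theorem Ach.wrap {w : RSig → ℕ} {S : List RL} {a : ℕ} {x y : RL} (hxy : LMatches x y)
    (h1 : Ach w S a) : Ach w (x :: (S ++ [y])) (w (sig x) + a) := by
  obtain ⟨A, hA, rfl⟩ := h1
  have fA := hA.pad (X := [x]) (Y := [y])
  have sA := pad_sum w hA (X := [x]) (Y := [y])
  have hlA : ∀ p ∈ A.map (shp [x].length), 0 < p.1 ∧ p.1 < p.2 ∧ p.2 < S.length + 1 := by
    intro p hp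
    have := fA.1 p hp
    obtain ⟨q, hq, rfl⟩ := Finset.mem_map.1 hp
    have := hA.1 q hq
    simp [shp_apply]; omega
  have hnot : (0, S.length + 1) ∉ A.map (shp [x].length) := by
    intro h
    have := hlA _ h
    simp at this
  refine ⟨insert (0, S.length + 1) (A.map (shp [x].length)), ⟨?_, ?_⟩, ?_⟩
  · intro p hp
    rcases Finset.mem_insert.1 hp with rfl | hp
    · refine ⟨by simp, by simp, x, by simp, y, by simp, hxy⟩
    · exact fA.1 p hp
  · intro p hp q hq hpq
    rcases Finset.mem_insert.1 hp with rfl | hp <;> rcases Finset.mem_insert.1 hq with rfl | hq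
    · exact absurd rfl hpq
    · have := hlA q hq
      simp only [Crosses]; omega
    · have := hlA p hp
      simp only [Crosses]; omega
    · exact fA.2 p hp q hq hpq
  · rw [Finset.sum_insert hnot]
    congr 1
    cases x <;> rfl

theorem Ach.cons {w : RSig → ℕ} {S : List RL} {a : ℕ} (x : RL) (h : Ach w S a) :
    Ach w (x :: S) a := by
  have := (Ach.zero w [x]).append h
  rwa [Nat.zero_add] at this

theorem Ach.snoc {w : RSig → ℕ} {S : List RL} {a : ℕ} (T : List RL) (h : Ach w S a) :
    Ach w (S ++ T) a := h.append (Ach.zero w T)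

theorem matches_flip (x : RL) : LMatches x x.swap := by
  cases x <;> simp [LMatches]

/-- nested matching along a common sublist -/
theorem Ach.nest {w : RSig → ℕ} {M : List RL} {m : ℕ} (hM : Ach w M m) :
    ∀ {Z X : List RL}, Z.Sublist X → ∀ Y : List RL, (Z.map Sum.swap).Sublist Y →
    Ach w (X ++ (M ++ Y.reverse)) ((Z.map (fun x => w (sig x))).sum + m) := by
  intro Z X hX
  induction hX with
  | slnil =>
    intro Y _
    simpa using hM.snoc Y.reverse
  | cons x _ ih =>
    intro Y hY
    exact (ih Y hY).cons x
  | @cons_cons Z X x _ ih =>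
    intro Y
    induction Y with
    | nil => intro hY; simp at hY
    | cons y Y ihY =>
      intro hY
      rw [List.map_cons] at hY
      cases hY with
      | cons _ h =>
        have := (ihY h).snoc [y]
        simpa using this
      | cons_cons _ h =>
        have := (ih Y h).wrap (matches_flip x)
        simpa [add_assoc] using this

/-! ### The six-segment string -/

def mL (p : PT) (s : List RBase) : List RL := s.map (fun b => Sum.inl (RSig.mk b p))

def mR (p : PT) (s : List RBase) : List RL := s.map (fun b => Sum.inr (RSig.mk b p))

def mkl (p : PT) (s : List RBase) : List RSig := s.map (fun b => RSig.mk b p)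

def six (N1 L1 N2 L2 N3 L3 : List RBase) : List RL :=
  mL .ag N1 ++ (((mR .ab L2).reverse ++ mL .ab N2) ++ ((mR .bg L3).reverse ++ mL .bg N3)
    ++ (mR .ag L1).reverse)

def isPT (p : PT) : RSig → Bool
  | .mk _ q => decide (q = p)
  | _ => false

def base : RSig → RBase
  | .mk b _ => b
  | _ => .g

theorem mL_sig (p : PT) (s : List RBase) : (mL p s).map sig = mkl p s := by
  simp [mL, mkl, sig]

theorem mR_sig (p : PT) (s : List RBase) : (mR p s).map sig = mkl p s := by
  simp [mR, mkl, sig]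

theorem mkl_filter_self (p : PT) (s : List RBase) : (mkl p s).filter (isPT p) = mkl p s := by
  rw [List.filter_eq_self]
  simp [mkl, isPT]

theorem mkl_filter_ne (p q : PT) (h : q ≠ p) (s : List RBase) :
    (mkl q s).filter (isPT p) = [] := by
  rw [List.filter_eq_nil_iff]
  simp [mkl, isPT, h]

theorem mem_mL {p : PT} {s : List RBase} {x : RL} (h : x ∈ mL p s) :
    x.isLeft = true ∧ ∃ b, sig x = .mk b p := by
  simp only [mL, List.mem_map] at h
  obtain ⟨b, -, rfl⟩ := h
  exact ⟨rfl, b, rfl⟩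

theorem mem_mR {p : PT} {s : List RBase} {x : RL} (h : x ∈ mR p s) :
    x.isLeft = false ∧ ∃ b, sig x = .mk b p := by
  simp only [mR, List.mem_map] at h
  obtain ⟨b, -, rfl⟩ := h
  exact ⟨rfl, b, rfl⟩

theorem from_common (n k : ℕ) (p : PT) (N L : List RBase) (Y : List RSig)
    (h1 : Y.Sublist (mkl p N)) (h2 : Y.Sublist (mkl p L)) :
    ∃ W : List RBase, W.Sublist N ∧ W.Sublist L ∧
      (Y.map (wt n k)).sum = (W.map (wb n k)).sum := by
  have hb : ∀ s, (mkl p s).map base = s := by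
    intro s
    simp [mkl, base, Function.comp_def]
  refine ⟨Y.map base, ?_, ?_, ?_⟩
  · simpa [hb] using h1.map base
  · simpa [hb] using h2.map base
  · rw [List.map_map]
    congr 1
    apply List.map_congr_left
    intro y hy
    have := h1.subset hy
    simp only [mkl, List.mem_map] at this
    obtain ⟨b, -, rfl⟩ := this
    cases b <;> rfl

open Classical in
theorem extract' (w : RSig → ℕ) (T : RSig → Bool) (S P R : List RL) (hS : S = P ++ R) (b : Bool)
    (hP : ∀ x ∈ P, T (sig x) = true → x.isLeft = b)
    (hR : ∀ x ∈ R, T (sig x) = true → x.isLeft = !b)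
    (A : Finset (ℕ × ℕ)) (hA : IsFolding S A) :
    ∃ Z : List RSig, Z.Sublist ((P.map sig).filter T) ∧
      Z.reverse.Sublist ((R.map sig).filter T) ∧
      ∑ p ∈ A.filter (fun p => ∃ x ∈ S[p.1]?, T (sig x) = true),
        (S.map (Sum.elim w w)).getD p.1 0 = (Z.map w).sum := by
  subst hS
  exact extract w T P R b hP hR A hA

theorem six_upper (n k : ℕ) (N1 L1 N2 L2 N3 L3 : List RBase) (m : ℕ)
    (h : Ach (wt n k) (six N1 L1 N2 L2 N3 L3) m) :
    ∃ Z1 Z2 Z3 : List RBase, (Z1.Sublist N1 ∧ Z1.Sublist L1) ∧ (Z2.Sublist N2 ∧ Z2.Sublist L2) ∧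
      (Z3.Sublist N3 ∧ Z3.Sublist L3) ∧
      m = (Z1.map (wb n k)).sum + (Z2.map (wb n k)).sum + (Z3.map (wb n k)).sum := by
  classical
  obtain ⟨A, hA, rfl⟩ := h
  have aux : ∀ (p q : PT) (s : List RBase) (x : RL) (c : Bool), q ≠ p →
      (∃ b, sig x = .mk b q) → isPT p (sig x) = true → x.isLeft = c := by
    intro p q s x c hpq ⟨b, hb⟩ hT
    rw [hb] at hT
    simp [isPT, hpq] at hT
  obtain ⟨Y1, a1, b1, c1⟩ := extract' (wt n k) (isPT .ag) (six N1 L1 N2 L2 N3 L3)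
    (mL .ag N1) _ rfl true (fun x hx _ => (mem_mL hx).1) (by
      intro x hx hT
      simp only [List.mem_append, List.mem_reverse] at hx
      rcases hx with ((hx | hx) | (hx | hx)) | hx
      · exact aux _ _ [] x _ (by decide) (mem_mR hx).2 hT
      · exact aux _ _ [] x _ (by decide) (mem_mL hx).2 hT
      · exact aux _ _ [] x _ (by decide) (mem_mR hx).2 hT
      · exact aux _ _ [] x _ (by decide) (mem_mL hx).2 hT
      · exact (mem_mR hx).1) A hA
  obtain ⟨Y2, a2, b2, c2⟩ := extract' (wt n k) (isPT .ab) (six N1 L1 N2 L2 N3 L3)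
    (mL .ag N1 ++ (mR .ab L2).reverse)
    (mL .ab N2 ++ ((mR .bg L3).reverse ++ mL .bg N3) ++ (mR .ag L1).reverse)
    (by simp [six]) false (by
      intro x hx hT
      simp only [List.mem_append, List.mem_reverse] at hx
      rcases hx with hx | hx
      · exact aux _ _ [] x _ (by decide) (mem_mL hx).2 hT
      · exact (mem_mR hx).1) (by
      intro x hx hT
      simp only [List.mem_append, List.mem_reverse] at hx
      rcases hx with (hx | (hx | hx)) | hx
      · exact (mem_mL hx).1
      · exact aux _ _ [] x _ (by decide) (mem_mR hx).2 hT
      · exact aux _ _ [] x _ (by decide) (mem_mL hx).2 hT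
      · exact aux _ _ [] x _ (by decide) (mem_mR hx).2 hT) A hA
  obtain ⟨Y3, a3, b3, c3⟩ := extract' (wt n k) (isPT .bg) (six N1 L1 N2 L2 N3 L3)
    (mL .ag N1 ++ ((mR .ab L2).reverse ++ mL .ab N2) ++ (mR .bg L3).reverse)
    (mL .bg N3 ++ (mR .ag L1).reverse)
    (by simp [six]) false (by
      intro x hx hT
      simp only [List.mem_append, List.mem_reverse] at hx
      rcases hx with (hx | (hx | hx)) | hx
      · exact aux _ _ [] x _ (by decide) (mem_mL hx).2 hT
      · exact aux _ _ [] x _ (by decide) (mem_mR hx).2 hT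
      · exact aux _ _ [] x _ (by decide) (mem_mL hx).2 hT
      · exact (mem_mR hx).1) (by
      intro x hx hT
      simp only [List.mem_append, List.mem_reverse] at hx
      rcases hx with hx | hx
      · exact (mem_mL hx).1
      · exact aux _ _ [] x _ (by decide) (mem_mR hx).2 hT) A hA
  simp only [List.map_append, List.filter_append, List.map_reverse, List.filter_reverse,
    mL_sig, mR_sig, mkl_filter_self, mkl_filter_ne PT.ag PT.ab (by decide),
    mkl_filter_ne PT.ag PT.bg (by decide), mkl_filter_ne PT.ab PT.ag (by decide),
    mkl_filter_ne PT.ab PT.bg (by decide), mkl_filter_ne PT.bg PT.ab (by decide),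
    mkl_filter_ne PT.bg PT.ag (by decide), List.reverse_nil, List.nil_append, List.append_nil]
    at a1 b1 a2 b2 a3 b3
  rw [List.reverse_sublist] at b1
  have a2' := a2.reverse
  have a3' := a3.reverse
  rw [List.reverse_reverse] at a2' a3'
  obtain ⟨W1, u1, v1, s1⟩ := from_common n k _ _ _ _ a1 b1
  obtain ⟨W2, u2, v2, s2⟩ := from_common n k _ _ _ _ b2 a2'
  obtain ⟨W3, u3, v3, s3⟩ := from_common n k _ _ _ _ b3 a3'
  refine ⟨W1, W2, W3, ⟨u1, v1⟩, ⟨u2, v2⟩, ⟨u3, v3⟩, ?_⟩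
  rw [List.map_reverse, List.sum_reverse] at s2 s3
  rw [← s1, ← s2, ← s3, ← c1, ← c2, ← c3, Finset.sum_filter, Finset.sum_filter,
    Finset.sum_filter, ← Finset.sum_add_distrib, ← Finset.sum_add_distrib]
  apply Finset.sum_congr rfl
  intro p hp
  obtain ⟨-, -, x, hx, -⟩ := hA.1 p hp
  rw [Option.mem_def] at hx
  have hex : ∀ T : RSig → Bool, (∃ y ∈ (six N1 L1 N2 L2 N3 L3)[p.1]?, T (sig y) = true) ↔
      T (sig x) = true := by
    intro T
    rw [hx]
    simp
  simp only [hex]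
  have hxS : x ∈ six N1 L1 N2 L2 N3 L3 := List.mem_of_getElem? hx
  have hq : ∃ b q, sig x = .mk b q := by
    simp only [six, List.mem_append, List.mem_reverse] at hxS
    rcases hxS with hx | (((hx | hx) | (hx | hx)) | hx)
    · obtain ⟨b, hb⟩ := (mem_mL hx).2; exact ⟨b, _, hb⟩
    · obtain ⟨b, hb⟩ := (mem_mR hx).2; exact ⟨b, _, hb⟩
    · obtain ⟨b, hb⟩ := (mem_mL hx).2; exact ⟨b, _, hb⟩
    · obtain ⟨b, hb⟩ := (mem_mR hx).2; exact ⟨b, _, hb⟩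
    · obtain ⟨b, hb⟩ := (mem_mL hx).2; exact ⟨b, _, hb⟩
    · obtain ⟨b, hb⟩ := (mem_mR hx).2; exact ⟨b, _, hb⟩
  obtain ⟨b, q, hq⟩ := hq
  rw [hq]
  cases q <;> simp [isPT]

theorem wb_wt (n k : ℕ) (b : RBase) (p : PT) : wt n k (.mk b p) = wb n k b := by
  cases b <;> rfl

theorem six_lower (n k : ℕ) (N1 L1 N2 L2 N3 L3 Z1 Z2 Z3 : List RBase)
    (h1 : Z1.Sublist N1) (h1' : Z1.Sublist L1) (h2 : Z2.Sublist N2) (h2' : Z2.Sublist L2)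
    (h3 : Z3.Sublist N3) (h3' : Z3.Sublist L3) :
    Ach (wt n k) (six N1 L1 N2 L2 N3 L3)
      ((Z1.map (wb n k)).sum + ((Z2.map (wb n k)).sum + (Z3.map (wb n k)).sum)) := by
  have sL : ∀ p Z, (mL p Z).map Sum.swap = mR p Z := by
    intro p Z; simp [mL, mR]
  have sR : ∀ p Z, (mR p Z).map Sum.swap = mL p Z := by
    intro p Z; simp [mL, mR]
  have wL : ∀ p Z, ((mL p Z).map (fun x => wt n k (sig x))).sum = (Z.map (wb n k)).sum := by
    intro p Z
    simp [mL, sig, wb_wt, Function.comp_def]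
  have wR : ∀ p Z, ((mR p Z).reverse.map (fun x => wt n k (sig x))).sum
      = (Z.map (wb n k)).sum := by
    intro p Z
    rw [List.map_reverse, List.sum_reverse]
    simp [mR, sig, wb_wt, Function.comp_def]
  have inner : ∀ (p : PT) (Z N L : List RBase), Z.Sublist N → Z.Sublist L →
      Ach (wt n k) ((mR p L).reverse ++ mL p N) (Z.map (wb n k)).sum := by
    intro p Z N L hN hL
    have := Ach.nest (Ach.zero (wt n k) []) (Z := (mR p Z).reverse) (X := (mR p L).reverse)
      (hL.map _).reverse (mL p N).reverse (by
        rw [List.map_reverse, sR]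
        exact (hN.map _).reverse)
    rw [wR] at this
    simpa using this
  have := Ach.nest ((inner .ab Z2 N2 L2 h2 h2').append (inner .bg Z3 N3 L3 h3 h3'))
    (Z := mL .ag Z1) (X := mL .ag N1) (h1.map _) (mR .ag L1) (by
      rw [sL]; exact h1'.map _)
  rw [wL] at this
  exact this

/-! ### Putting things together -/

theorem CNGr_flag (n k : ℕ) (t : Finset (Fin n)) : ∀ x ∈ CNGr n k t, x.1 = false := by
  intro x hx
  simp only [CNGr, rep, List.mem_flatMap, List.mem_flatten, List.mem_replicate] at hx
  obtain ⟨v, -, l, ⟨-, rfl⟩, hx⟩ := hx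
  simp only [NGr, bin, hsh, dol, List.mem_append, List.mem_replicate, List.mem_singleton,
    List.mem_map] at hx
  rcases hx with (rfl | (⟨-, rfl⟩ | ⟨i, -, rfl⟩) | ⟨-, rfl⟩) | rfl <;> rfl

theorem CLGr_flag (n k : ℕ) (G : SimpleGraph (Fin n)) (t : Finset (Fin n)) :
    ∀ x ∈ CLGr n k G t, x.1 = false := by
  intro x hx
  simp only [CLGr, rep, List.mem_flatten, List.mem_replicate] at hx
  obtain ⟨l, ⟨-, rfl⟩, hx⟩ := hx
  simp only [LGr, bin, hsh, dol, List.mem_append, List.mem_singleton, List.mem_flatMap,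
    List.mem_map, List.mem_cons, List.not_mem_nil, or_false] at hx
  obtain ⟨v, -, hx⟩ := hx
  rcases hx with (rfl | ⟨u, -, (rfl | ⟨i, -, rfl⟩) | rfl⟩ | ⟨u, -, rfl | rfl⟩) | rfl <;> rfl

theorem seg_N (n k : ℕ) (p : PT) (t s : Finset (Fin n)) (hs : s.card = k) :
    markStr p ([(false, .g)] ++ CNGr n k t ++ [(false, .g)])
      = mL p (gw (NP n (t.toList.product s.toList))) := by
  rw [← CNGr_snd n k t s hs]
  have : (CNGr n k t).map (mark p)
      = ((CNGr n k t).map Prod.snd).map (fun b => Sum.inl (RSig.mk b p)) := by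
    rw [List.map_map]
    apply List.map_congr_left
    rintro ⟨f, b⟩ hx
    obtain rfl : f = false := CNGr_flag n k t _ hx
    rfl
  simp only [markStr, mL, gw, List.map_append, List.map_cons, this, List.map_nil]
  rfl

theorem seg_L (n k : ℕ) (G : SimpleGraph (Fin n)) (p : PT) (t s : Finset (Fin n))
    (ht : t.card = k) :
    markStr p ([(true, .g)] ++ (primeStr (CLGr n k G s)).reverse ++ [(true, .g)])
      = (mR p (gw (LP n G (t.toList.product s.toList)))).reverse := by
  rw [← CLGr_snd n k G t s ht]
  have : (primeStr (CLGr n k G s)).map (mark p)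
      = ((CLGr n k G s).map Prod.snd).map (fun b => Sum.inr (RSig.mk b p)) := by
    rw [primeStr, List.map_map, List.map_map]
    apply List.map_congr_left
    rintro ⟨f, b⟩ hx
    obtain rfl : f = false := CLGr_flag n k G s _ hx
    rfl
  simp only [markStr, mR, gw, List.map_append, List.map_cons, this, List.map_nil,
    List.map_reverse, List.reverse_append, List.reverse_cons, List.reverse_nil]
  rfl

theorem whole (n k : ℕ) (G : SimpleGraph (Fin n)) (ta tb tc : Finset (Fin n))
    (ha : ta.card = k) (hb : tb.card = k) (hc : tc.card = k) :
    CGa n k G ta ++ CGb n k G tb ++ CGg n k G tc =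
    six (gw (NP n (ta.toList.product tc.toList))) (gw (LP n G (ta.toList.product tc.toList)))
      (gw (NP n (tb.toList.product ta.toList))) (gw (LP n G (tb.toList.product ta.toList)))
      (gw (NP n (tc.toList.product tb.toList))) (gw (LP n G (tc.toList.product tb.toList))) := by
  rw [CGa, CGb, CGg, seg_N n k .ag ta tc hc, seg_L n k G .ab tb ta hb, seg_N n k .ab tb ta ha,
    seg_L n k G .bg tc tb hc, seg_N n k .bg tc tb hb, seg_L n k G .ag ta tc ha]
  simp only [six, List.append_assoc]

theorem union_clique (n k : ℕ) (G : SimpleGraph (Fin n)) (ta tb tc : Finset (Fin n))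
    (ha : G.IsNClique k ta) (hb : G.IsNClique k tb) (hc : G.IsNClique k tc)
    (hac : ∀ u ∈ ta, ∀ v ∈ tc, G.Adj v u) (hba : ∀ u ∈ tb, ∀ v ∈ ta, G.Adj v u)
    (hcb : ∀ u ∈ tc, ∀ v ∈ tb, G.Adj v u) : G.IsNClique (3 * k) (ta ∪ tb ∪ tc) := by
  rw [SimpleGraph.isNClique_iff] at *
  constructor
  · intro u hu v hv huv
    have qa := ha.1
    have qb := hb.1
    have qc := hc.1
    simp only [Finset.coe_union, Set.mem_union, Finset.mem_coe] at hu hv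
    rcases hu with (hu | hu) | hu <;> rcases hv with (hv | hv) | hv
    · exact qa hu hv huv
    · exact hba v hv u hu
    · exact (hac u hu v hv).symm
    · exact (hba u hu v hv).symm
    · exact qb hu hv huv
    · exact hcb v hv u hu
    · exact hac v hv u hu
    · exact (hcb u hu v hv).symm
    · exact qc hu hv huv
  · have d1 : Disjoint ta tb := by
      rw [Finset.disjoint_left]
      intro u h1 h2
      exact G.irrefl (hba u h2 u h1)
    have d2 : Disjoint (ta ∪ tb) tc := by
      rw [Finset.disjoint_left]
      intro u h1 h2
      rcases Finset.mem_union.1 h1 with h1 | h1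
      · exact G.irrefl (hac u h1 u h2)
      · exact G.irrefl (hcb u h2 u h1)
    rw [Finset.card_union_of_disjoint d2, Finset.card_union_of_disjoint d1, ha.2, hb.2, hc.2]
    ring

theorem clique_union (n k : ℕ) (G : SimpleGraph (Fin n)) (ta tb tc : Finset (Fin n))
    (ha : ta.card = k) (hb : tb.card = k) (hc : tc.card = k)
    (h : G.IsNClique (3 * k) (ta ∪ tb ∪ tc)) :
    (∀ u ∈ ta, ∀ v ∈ tc, G.Adj v u) ∧ (∀ u ∈ tb, ∀ v ∈ ta, G.Adj v u) ∧
    (∀ u ∈ tc, ∀ v ∈ tb, G.Adj v u) := by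
  rw [SimpleGraph.isNClique_iff] at h
  obtain ⟨h1, h2⟩ := h
  have e1 := Finset.card_union_add_card_inter (ta ∪ tb) tc
  have e2 := Finset.card_union_add_card_inter ta tb
  have z1 : ((ta ∪ tb) ∩ tc).card = 0 := by omega
  have z2 : (ta ∩ tb).card = 0 := by omega
  rw [Finset.card_eq_zero] at z1 z2
  have key : ∀ u ∈ ta ∪ tb ∪ tc, ∀ v ∈ ta ∪ tb ∪ tc, v ≠ u → G.Adj v u :=
    fun u hu v hv hvu => h1 (Finset.mem_coe.2 hv) (Finset.mem_coe.2 hu) hvu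
  refine ⟨fun u hu v hv => key u (by simp [hu]) v (by simp [hv]) ?_,
    fun u hu v hv => key u (by simp [hu]) v (by simp [hv]) ?_,
    fun u hu v hv => key u (by simp [hu]) v (by simp [hv]) ?_⟩
  · rintro rfl
    have : v ∈ (ta ∪ tb) ∩ tc := by simp [hu, hv]
    simp [z1] at this
  · rintro rfl
    have : v ∈ ta ∩ tb := by simp [hu, hv]
    simp [z2] at this
  · rintro rfl
    have : v ∈ (ta ∪ tb) ∩ tc := by simp [hu, hv]
    simp [z1] at this

/-- Claim 3.6 of the paper.
There is an integer `E₃` depending only on `n` and `k` (the paper computes `E₃ = 6ℓ₂ + 3E₂`)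
such that for every triple of `k`-cliques `t_α, t_β, t_γ ∈ C_k`: the weighted RNA folding
score `WRNA(CG_α(t_α) ∘ CG_β(t_β) ∘ CG_γ(t_γ))` equals `E₃` if `t_α ∪ t_β ∪ t_γ` forms a
`3k`-clique in `G`, and is at most `E₃ − 1` otherwise. -/
theorem wrna_clique_gadget_triple (n k : ℕ) :
    ∃ E₃ : ℕ, ∀ (G : SimpleGraph (Fin n)) (ta tb tc : Finset (Fin n)),
      G.IsNClique k ta → G.IsNClique k tb → G.IsNClique k tc →
      (G.IsNClique (3 * k) (ta ∪ tb ∪ tc) →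
        WRNA (wt n k) (CGa n k G ta ++ CGb n k G tb ++ CGg n k G tc) = E₃) ∧
      (¬ G.IsNClique (3 * k) (ta ∪ tb ∪ tc) →
        WRNA (wt n k) (CGa n k G ta ++ CGb n k G tb ++ CGg n k G tc) ≤ E₃ - 1) := by
  refine ⟨3 * EE n k, fun G ta tb tc ha hb hc => ?_⟩
  have ca := ha.card_eq
  have cb := hb.card_eq
  have cc := hc.card_eq
  rw [whole n k G ta tb tc ca cb cc]
  have len : ∀ s t : Finset (Fin n), s.card = k → t.card = k →
      (s.toList.product t.toList).length = k * k := by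
    intro s t hs ht
    have e : (s.toList.product t.toList).length = s.toList.length * t.toList.length :=
      List.length_product _ _
    rw [e, Finset.length_toList, Finset.length_toList, hs, ht]
  have memp : ∀ s t : Finset (Fin n), ∀ u ∈ s, ∀ v ∈ t, (u, v) ∈ s.toList.product t.toList := by
    intro s t u hu v hv
    exact List.pair_mem_product.2 ⟨Finset.mem_toList.2 hu, Finset.mem_toList.2 hv⟩
  set S := six (gw (NP n (ta.toList.product tc.toList)))
    (gw (LP n G (ta.toList.product tc.toList)))
    (gw (NP n (tb.toList.product ta.toList))) (gw (LP n G (tb.toList.product ta.toList)))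
    (gw (NP n (tc.toList.product tb.toList))) (gw (LP n G (tc.toList.product tb.toList))) with hS
  have upper : ∀ m, Ach (wt n k) S m → m ≤ 3 * EE n k := by
    intro m hm
    obtain ⟨Z1, Z2, Z3, ⟨a1, b1⟩, ⟨a2, b2⟩, ⟨a3, b3⟩, rfl⟩ := six_upper n k _ _ _ _ _ _ m hm
    have := pair_le n k G _ (len ta tc ca cc) Z1 a1 b1
    have := pair_le n k G _ (len tb ta cb ca) Z2 a2 b2
    have := pair_le n k G _ (len tc tb cc cb) Z3 a3 b3
    omega
  have hW : WRNA (wt n k) S = sSup {m | Ach (wt n k) S m} := rfl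
  have hne : {m | Ach (wt n k) S m}.Nonempty := ⟨0, Ach.zero _ _⟩
  rw [hW]
  constructor
  · intro h
    obtain ⟨hac, hba, hcb⟩ := clique_union n k G ta tb tc ca cb cc h
    have adj : ∀ s t : Finset (Fin n), (∀ u ∈ s, ∀ v ∈ t, G.Adj v u) →
        ∀ p ∈ s.toList.product t.toList, G.Adj p.2 p.1 := by
      rintro s t hst ⟨u, v⟩ hp
      replace hp := List.pair_mem_product.1 hp
      simp only [Finset.mem_toList] at hp
      exact hst u hp.1 v hp.2
    obtain ⟨Z1, a1, b1, c1⟩ := pair_exists n k G _ (len ta tc ca cc) (adj _ _ hac)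
    obtain ⟨Z2, a2, b2, c2⟩ := pair_exists n k G _ (len tb ta cb ca) (adj _ _ hba)
    obtain ⟨Z3, a3, b3, c3⟩ := pair_exists n k G _ (len tc tb cc cb) (adj _ _ hcb)
    have low := six_lower n k _ _ _ _ _ _ Z1 Z2 Z3 a1 b1 a2 b2 a3 b3
    rw [← hS, c1, c2, c3] at low
    apply le_antisymm
    · exact csSup_le hne upper
    · exact le_csSup ⟨_, upper⟩ (by
        have e : 3 * EE n k = EE n k + (EE n k + EE n k) := by ring
        rw [e]; exact low)
  · intro h
    apply csSup_le hne
    intro m hm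
    by_cases hn : 2 ≤ n
    · have hk : 1 ≤ k := by
        by_contra hk
        obtain rfl : k = 0 := by omega
        rw [Finset.card_eq_zero] at ca cb cc
        subst ca cb cc
        exact h (by simp)
      have hle := upper m hm
      by_contra hcon
      apply h
      obtain ⟨Z1, Z2, Z3, ⟨a1, b1⟩, ⟨a2, b2⟩, ⟨a3, b3⟩, rfl⟩ := six_upper n k _ _ _ _ _ _ m hm
      have e1 := pair_le n k G _ (len ta tc ca cc) Z1 a1 b1
      have e2 := pair_le n k G _ (len tb ta cb ca) Z2 a2 b2
      have e3 := pair_le n k G _ (len tc tb cc cb) Z3 a3 b3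
      have q1 := pair_eq n k hn hk G _ (len ta tc ca cc) Z1 a1 b1 (by omega)
      have q2 := pair_eq n k hn hk G _ (len tb ta cb ca) Z2 a2 b2 (by omega)
      have q3 := pair_eq n k hn hk G _ (len tc tb cc cb) Z3 a3 b3 (by omega)
      exact union_clique n k G ta tb tc ha hb hc
        (fun u hu v hv => q1 (u, v) (memp _ _ u hu v hv))
        (fun u hu v hv => q2 (u, v) (memp _ _ u hu v hv))
        (fun u hu v hv => q3 (u, v) (memp _ _ u hu v hv))
    · have hE : EE n k = 0 := by
        have : n = 0 ∨ n = 1 := by omega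
        rcases this with rfl | rfl <;> simp [EE, l2, l1, logn]
      have := upper m hm
      omega

end RNAFolding
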